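/- Let m ≥ 1 be an integer, h > 0 a real number, D the line-lattice Dirac operator of size 2m and, for λ ∈ ℂ^m, let a_λ and da_λ = [D, a_λ] be as defined. Then the spectrum of the matrix da_λ is σ(da_λ) = {0} ∪ {(i/h)(λ_{j+1} − λ_j) : 1 ≤ j ≤ m−1} ∪ {−(i/h)(λ_{j+1} − λ_j) : 1 ≤ j ≤ m−1}. -/

import Mathlib

open Matrix

/-- The off-diagonal block of the line-lattice Dirac operator:
`(D⁻)_{j,j+1} = 1` for `1 ≤ j ≤ m-1` (one-based), all other entries `0`. -/
noncomputable def Dminus (m : ℕ) : Matrix (Fin m) (Fin m) ℂ :=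
  fun i j => if (i : ℕ) + 1 = (j : ℕ) then 1 else 0

/-- The line-lattice Dirac operator `D = (i/h) • [[0, D⁻], [-(D⁻)ᵀ, 0]]` of size `2m`. -/
noncomputable def Dirac (m : ℕ) (h : ℝ) : Matrix (Fin m ⊕ Fin m) (Fin m ⊕ Fin m) ℂ :=
  (Complex.I / (h : ℂ)) • Matrix.fromBlocks 0 (Dminus m) (-(Dminus m)ᵀ) 0

/-- The diagonal matrix `a_λ = diag(λ₁, …, λ_m, λ₁, …, λ_m)`. -/
noncomputable def aDiag {m : ℕ} (lam : Fin m → ℂ) :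
    Matrix (Fin m ⊕ Fin m) (Fin m ⊕ Fin m) ℂ :=
  Matrix.diagonal (Sum.elim lam lam)

/-- The commutator `da_λ = [D, a_λ] = D a_λ - a_λ D`. -/
noncomputable def da (m : ℕ) (h : ℝ) (lam : Fin m → ℂ) :
    Matrix (Fin m ⊕ Fin m) (Fin m ⊕ Fin m) ℂ :=
  Dirac m h * aDiag lam - aDiag lam * Dirac m h


theorem da_ll (m : ℕ) (h : ℝ) (lam : Fin m → ℂ) (i j : Fin m) :
    da m h lam (Sum.inl i) (Sum.inl j) = 0 := by
  simp [da, Dirac, aDiag, Matrix.sub_apply, Matrix.mul_diagonal, Matrix.diagonal_mul]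

theorem da_rr (m : ℕ) (h : ℝ) (lam : Fin m → ℂ) (i j : Fin m) :
    da m h lam (Sum.inr i) (Sum.inr j) = 0 := by
  simp [da, Dirac, aDiag, Matrix.sub_apply, Matrix.mul_diagonal, Matrix.diagonal_mul]

theorem da_lr (m : ℕ) (h : ℝ) (lam : Fin m → ℂ) (i j : Fin m) :
    da m h lam (Sum.inl i) (Sum.inr j) =
      if (i : ℕ) + 1 = j then Complex.I / (h : ℂ) * (lam j - lam i) else 0 := by
  simp only [da, Dirac, aDiag, Matrix.sub_apply, Matrix.mul_diagonal, Matrix.diagonal_mul,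
    Matrix.smul_apply, Matrix.fromBlocks_apply₁₂, Dminus, Sum.elim_inl, Sum.elim_inr, smul_eq_mul]
  split_ifs <;> ring

theorem da_rl (m : ℕ) (h : ℝ) (lam : Fin m → ℂ) (i j : Fin m) :
    da m h lam (Sum.inr i) (Sum.inl j) =
      if (j : ℕ) + 1 = i then Complex.I / (h : ℂ) * (lam i - lam j) else 0 := by
  simp only [da, Dirac, aDiag, Matrix.sub_apply, Matrix.mul_diagonal, Matrix.diagonal_mul,
    Matrix.smul_apply, Matrix.fromBlocks_apply₂₁, Dminus, Sum.elim_inl, Sum.elim_inr, smul_eq_mul,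
    Matrix.neg_apply, Matrix.transpose_apply]
  split_ifs <;> ring

theorem mem_spec_iff (m : ℕ) (h : ℝ) (lam : Fin m → ℂ) (z : ℂ) :
    z ∈ spectrum ℂ (da m h lam) ↔ ∃ v, v ≠ 0 ∧ da m h lam *ᵥ v = z • v := by
  rw [← Matrix.spectrum_toLin', ← Module.End.hasEigenvalue_iff_mem_spectrum]
  constructor
  · intro hz
    obtain ⟨v, hv⟩ := hz.exists_hasEigenvector
    exact ⟨v, hv.2, by simpa using hv.apply_eq_smul⟩
  · rintro ⟨v, hv, e⟩
    exact Module.End.hasEigenvalue_of_hasEigenvector (x := v)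
      ⟨Module.End.mem_eigenspace_iff.2 (by simpa using e), hv⟩

theorem mv_l (m : ℕ) (h : ℝ) (lam : Fin m → ℂ) (v : Fin m ⊕ Fin m → ℂ) (i : Fin m) :
    (da m h lam *ᵥ v) (Sum.inl i) = ∑ j : Fin m,
      if (i : ℕ) + 1 = j then Complex.I / (h : ℂ) * (lam j - lam i) * v (Sum.inr j) else 0 := by
  simp [Matrix.mulVec, dotProduct, da_ll, da_lr, ite_mul]

theorem mv_r (m : ℕ) (h : ℝ) (lam : Fin m → ℂ) (v : Fin m ⊕ Fin m → ℂ) (i : Fin m) :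
    (da m h lam *ᵥ v) (Sum.inr i) = ∑ j : Fin m,
      if (j : ℕ) + 1 = i then Complex.I / (h : ℂ) * (lam i - lam j) * v (Sum.inl j) else 0 := by
  simp [Matrix.mulVec, dotProduct, da_rr, da_rl, ite_mul]

theorem mv_l_succ (m : ℕ) (h : ℝ) (lam : Fin m → ℂ) (v : Fin m ⊕ Fin m → ℂ) (i j : Fin m)
    (hij : (i : ℕ) + 1 = j) :
    (da m h lam *ᵥ v) (Sum.inl i) = Complex.I / (h : ℂ) * (lam j - lam i) * v (Sum.inr j) := by
  rw [mv_l, Finset.sum_eq_single j]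
  · simp [hij]
  · intro b _ hb
    rw [if_neg]
    intro e
    exact hb (Fin.ext (by omega))
  · simp

theorem mv_r_succ (m : ℕ) (h : ℝ) (lam : Fin m → ℂ) (v : Fin m ⊕ Fin m → ℂ) (i j : Fin m)
    (hij : (i : ℕ) + 1 = j) :
    (da m h lam *ᵥ v) (Sum.inr j) = Complex.I / (h : ℂ) * (lam j - lam i) * v (Sum.inl i) := by
  rw [mv_r, Finset.sum_eq_single i]
  · simp [hij]
  · intro b _ hb
    rw [if_neg]
    intro e
    exact hb (Fin.ext (by omega))
  · simp

theorem mv_l_last (m : ℕ) (h : ℝ) (lam : Fin m → ℂ) (v : Fin m ⊕ Fin m → ℂ) (i : Fin m)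
    (hi : ¬ (i : ℕ) + 1 < m) : (da m h lam *ᵥ v) (Sum.inl i) = 0 := by
  rw [mv_l]
  refine Finset.sum_eq_zero fun j _ => if_neg ?_
  omega

theorem mv_r_zero (m : ℕ) (h : ℝ) (lam : Fin m → ℂ) (v : Fin m ⊕ Fin m → ℂ) (i : Fin m)
    (hi : (i : ℕ) = 0) : (da m h lam *ᵥ v) (Sum.inr i) = 0 := by
  rw [mv_r]
  refine Finset.sum_eq_zero fun j _ => if_neg ?_
  omega

theorem two_block {z d x y : ℂ} (h1 : d * y = z * x) (h2 : d * x = z * y)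
    (hxy : x ≠ 0 ∨ y ≠ 0) : z = d ∨ z = -d := by
  have hx : (z - d) * (z + d) * x = 0 := by linear_combination (-z) * h1 - d * h2
  have hy : (z - d) * (z + d) * y = 0 := by linear_combination (-z) * h2 - d * h1
  have : (z - d) * (z + d) = 0 := by
    rcases hxy with h | h
    · exact (mul_eq_zero.1 hx).resolve_right h
    · exact (mul_eq_zero.1 hy).resolve_right h
  rcases mul_eq_zero.1 this with h | h
  · exact Or.inl (sub_eq_zero.1 h)
  · exact Or.inr (eq_neg_of_add_eq_zero_left h)

/-- The block eigenvectors. -/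
theorem mem_spec_block (m : ℕ) (h : ℝ) (lam : Fin m → ℂ) (i j : Fin m)
    (hij : (i : ℕ) + 1 = j) (s : ℂ) (hs : s * s = 1) :
    s * (Complex.I / (h : ℂ) * (lam j - lam i)) ∈ spectrum ℂ (da m h lam) := by
  rw [mem_spec_iff]
  refine ⟨Sum.elim (Pi.single i 1) (Pi.single j s), ?_, ?_⟩
  · intro e
    have := congrFun e (Sum.inl i)
    simp at this
  · ext k
    rcases k with k | k
    · by_cases hk : (k : ℕ) + 1 < m
      · rw [mv_l_succ m h lam _ k ⟨k + 1, hk⟩ rfl]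
        by_cases hki : k = i
        · subst hki
          have : j = ⟨k + 1, hk⟩ := Fin.ext hij.symm
          subst this
          simp
          ring
        · have : (⟨k + 1, hk⟩ : Fin m) ≠ j := by
            intro e
            apply hki
            rw [← e] at hij
            exact Fin.ext (by simpa using hij.symm)
          simp [hki, this]
      · rw [mv_l_last m h lam _ k hk]
        have : k ≠ i := by
          rintro rfl
          omega
        simp [this]
    · by_cases hk : (k : ℕ) = 0
      · rw [mv_r_zero m h lam _ k hk]
        have : k ≠ j := by
          rintro rfl
          omega
        simp [this]
      · have hk' : (k : ℕ) - 1 + 1 = k := by omega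
        rw [mv_r_succ m h lam _ ⟨k - 1, by omega⟩ k hk']
        by_cases hkj : k = j
        · subst hkj
          have : i = ⟨k - 1, by omega⟩ := Fin.ext (by simp; omega)
          rw [← this]
          simp
          linear_combination (-(Complex.I / (h : ℂ) * (lam k - lam i))) * hs
        · have : (⟨k - 1, by omega⟩ : Fin m) ≠ i := by
            intro e
            apply hkj
            rw [← e] at hij
            exact Fin.ext (by simp at hij; omega)
          simp [hkj, this]

/-- The spectrum of `da_λ` is
`{0} ∪ {(i/h)(λ_{j+1} - λ_j)} ∪ {-(i/h)(λ_{j+1} - λ_j)}` for `1 ≤ j ≤ m-1`. -/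
theorem spectrum_da (m : ℕ) (hm : 1 ≤ m) (h : ℝ) (hh : 0 < h) (lam : Fin m → ℂ) :
    spectrum ℂ (da m h lam) =
      ({0} : Set ℂ)
        ∪ {z : ℂ | ∃ (j : ℕ) (hj : j + 1 < m),
            z = Complex.I / (h : ℂ) *
              (lam ⟨j + 1, hj⟩ - lam ⟨j, Nat.lt_of_succ_lt hj⟩)}
        ∪ {z : ℂ | ∃ (j : ℕ) (hj : j + 1 < m),
            z = -(Complex.I / (h : ℂ) *
              (lam ⟨j + 1, hj⟩ - lam ⟨j, Nat.lt_of_succ_lt hj⟩))} := by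
  ext z
  simp only [Set.mem_union, Set.mem_singleton_iff, Set.mem_ofPred_eq]
  constructor
  · rw [mem_spec_iff]
    rintro ⟨v, hv, e⟩
    by_cases hz : z = 0
    · exact Or.inl (Or.inl hz)
    have key : ∀ (i : ℕ) (hi : i + 1 < m),
        (v (Sum.inl ⟨i, Nat.lt_of_succ_lt hi⟩) ≠ 0 ∨ v (Sum.inr ⟨i + 1, hi⟩) ≠ 0) →
        z = Complex.I / (h : ℂ) * (lam ⟨i + 1, hi⟩ - lam ⟨i, Nat.lt_of_succ_lt hi⟩) ∨
        z = -(Complex.I / (h : ℂ) * (lam ⟨i + 1, hi⟩ - lam ⟨i, Nat.lt_of_succ_lt hi⟩)) := by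
      intro i hi hne
      refine two_block ?_ ?_ hne
      · rw [← mv_l_succ m h lam v ⟨i, Nat.lt_of_succ_lt hi⟩ ⟨i + 1, hi⟩ rfl, e]
        rfl
      · rw [← mv_r_succ m h lam v ⟨i, Nat.lt_of_succ_lt hi⟩ ⟨i + 1, hi⟩ rfl, e]
        rfl
    obtain ⟨k, hk⟩ := Function.ne_iff.1 hv
    have ek := congrFun e k
    rcases k with ⟨k, hkm⟩ | ⟨k, hkm⟩
    · by_cases hl : k + 1 < m
      · exact (key k hl (Or.inl hk)).elim
          (fun q => Or.inl (Or.inr ⟨k, hl, q⟩)) (fun q => Or.inr ⟨k, hl, q⟩)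
      · rw [mv_l_last m h lam v _ hl] at ek
        exact absurd ek.symm (mul_ne_zero hz hk)
    · rcases k with _ | k
      · rw [mv_r_zero m h lam v _ rfl] at ek
        exact absurd ek.symm (mul_ne_zero hz hk)
      · exact (key k hkm (Or.inr hk)).elim
          (fun q => Or.inl (Or.inr ⟨k, hkm, q⟩)) (fun q => Or.inr ⟨k, hkm, q⟩)
  · rintro ((rfl | ⟨j, hj, rfl⟩) | ⟨j, hj, rfl⟩)
    · rw [mem_spec_iff]
      refine ⟨Pi.single (Sum.inr ⟨0, hm⟩) 1, by simp, ?_⟩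
      ext k
      rcases k with k | k
      · rw [mv_l]
        simp only [zero_smul, Pi.zero_apply]
        refine Finset.sum_eq_zero fun j _ => ?_
        split_ifs with hj
        · have : j ≠ ⟨0, hm⟩ := by
            rintro rfl
            simp at hj
          simp [this]
        · rfl
      · rw [mv_r]
        simp
    · simpa using mem_spec_block m h lam ⟨j, Nat.lt_of_succ_lt hj⟩ ⟨j + 1, hj⟩ rfl 1 (by simp)
    · simpa only [neg_one_mul] using
        mem_spec_block m h lam ⟨j, Nat.lt_of_succ_lt hj⟩ ⟨j + 1, hj⟩ rfl (-1) (by simp)
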